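/- arXiv:1512.04494 — 2 statements merged into one kernel-verified Lean document; each statement's English description precedes it below -/
import Mathlib

section
/- Lemma A.3, bound (Leibniz7): let α > 0, let L be a finite index set and δ : L → [0,1]. Then there exists a constant c > 0, depending only on α, #L and δ, such that for all ε ∈ [0,1], all s : L → ℝ with s_ℓ > 0 for each ℓ ∈ L, and all t > 0: |Δ_{s_L}(u ↦ F_ε(u)^{−α})(t)| ≤ c · F_ε(t)^{−α} · t^{−|δ|} · Π_{ℓ∈L} s_ℓ^{δ_ℓ}, where |δ| := Σ_{ℓ∈L} δ_ℓ. -/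
open Finset

/-- Iterated finite difference `Δ_{s_L} g` over the finite index set `L`:
`(Δ_{s_L} g)(t) = ∑_{A ⊆ L} (-1)^{#L - #A} g(t + ∑_{ℓ∈A} s_ℓ)`. -/
noncomputable def iterDiff {ι : Type*} [DecidableEq ι] (L : Finset ι) (s : ι → ℝ)
    (g : ℝ → ℝ) (t : ℝ) : ℝ :=
  ∑ A ∈ L.powerset, (-1 : ℝ) ^ (L.card - A.card) * g (t + ∑ ℓ ∈ A, s ℓ)

/-- The building blocks `F^{-α} u^{-i} (ε/(1+εu))^j`. -/
noncomputable def phiAux (α ε : ℝ) (i j : ℕ) (u : ℝ) : ℝ :=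
  (u / (1 + ε * u)) ^ (-α) * (u⁻¹) ^ i * (ε / (1 + ε * u)) ^ j

/-- The weight in the inductive bound. -/
noncomputable def wAux {ι : Type*} (α ε : ℝ) (δ s : ι → ℝ) (S : Finset ι) (m : ℕ) (t : ℝ) : ℝ :=
  (t / (1 + ε * t)) ^ (-α) * (t⁻¹) ^ m * ∏ ℓ ∈ S, (s ℓ / t) ^ δ ℓ

theorem iterDiff_insert_aux {ι : Type*} [DecidableEq ι] (S : Finset ι) (a : ι) (ha : a ∉ S)
    (s : ι → ℝ) (g : ℝ → ℝ) (t : ℝ) :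
    iterDiff (insert a S) s g t = iterDiff S s g (t + s a) - iterDiff S s g t := by
  unfold iterDiff
  rw [Finset.sum_powerset_insert ha, add_comm, sub_eq_add_neg, ← Finset.sum_neg_distrib]
  congr 1
  · refine Finset.sum_congr rfl fun A hA => ?_
    have hA' := Finset.mem_powerset.1 hA
    have haA : a ∉ A := fun h => ha (hA' h)
    rw [Finset.card_insert_of_notMem ha, Finset.card_insert_of_notMem haA,
      Finset.sum_insert haA, Nat.add_sub_add_right, add_assoc]
  · refine Finset.sum_congr rfl fun A hA => ?_
    have hc := Finset.card_le_card (Finset.mem_powerset.1 hA)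
    rw [Finset.card_insert_of_notMem ha, Nat.succ_sub hc, pow_succ]
    ring

theorem phiAux_hasDerivAt (α ε : ℝ) (hε : 0 ≤ ε) (i j : ℕ) (u : ℝ) (hu : 0 < u) :
    HasDerivAt (phiAux α ε i j)
      ((-α - i) * phiAux α ε (i + 1) j u + (α - j) * phiAux α ε i (j + 1) u) u := by
  have hp : 0 < 1 + ε * u := by positivity
  have hF : 0 < u / (1 + ε * u) := by positivity
  have h1 : HasDerivAt (fun u : ℝ => 1 + ε * u) ε u := by
    simpa using ((hasDerivAt_id u).const_mul ε).const_add 1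
  have h2 := ((hasDerivAt_id u).div h1 hp.ne').rpow_const (p := -α) (Or.inl hF.ne')
  have h3 := (hasDerivAt_inv hu.ne').pow i
  have h4 := ((hasDerivAt_const u ε).div h1 hp.ne').pow j
  have h5 := (h2.mul h3).mul h4
  refine h5.congr_deriv ?_
  simp only [phiAux, Pi.mul_apply, Pi.pow_apply, Pi.div_apply, id]
  rw [Real.rpow_sub_one hF.ne']
  generalize (u / (1 + ε * u)) ^ (-α) = X
  have hi : (i : ℝ) * u⁻¹ ^ (i - 1) * u⁻¹ = i * u⁻¹ ^ i := by
    rcases i with _ | i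
    · simp
    · simp [pow_succ, mul_assoc]
  have hj : (j : ℝ) * (ε / (1 + ε * u)) ^ (j - 1) * (ε / (1 + ε * u))
      = j * (ε / (1 + ε * u)) ^ j := by
    rcases j with _ | j
    · simp
    · simp [pow_succ, mul_assoc]
  have e2 : (1 * (1 + ε * u) - u * ε) / (1 + ε * u) ^ 2 * -α * (X / (u / (1 + ε * u)))
      = -α * X * (u⁻¹ - ε / (1 + ε * u)) := by
    field_simp
    try ring
  have e3 : (i : ℝ) * u⁻¹ ^ (i - 1) * -(u ^ 2)⁻¹ = - (i * u⁻¹ ^ i * u⁻¹) := by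
    rw [← hi]; field_simp
  have e4 : (j : ℝ) * (ε / (1 + ε * u)) ^ (j - 1) * ((0 * (1 + ε * u) - ε * ε) / (1 + ε * u) ^ 2)
      = -(j * (ε / (1 + ε * u)) ^ j * (ε / (1 + ε * u))) := by
    rw [← hj]; field_simp; ring
  rw [e2, e3, e4]
  ring

theorem iterDiff_hasDerivAt_aux {ι : Type*} [DecidableEq ι] (S : Finset ι) (s : ι → ℝ)
    (hs : ∀ ℓ, 0 < s ℓ) (α ε : ℝ) (hε : 0 ≤ ε) (i j : ℕ) (u : ℝ) (hu : 0 < u) :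
    HasDerivAt (iterDiff S s (phiAux α ε i j))
      ((-α - i) * iterDiff S s (phiAux α ε (i + 1) j) u
        + (α - j) * iterDiff S s (phiAux α ε i (j + 1)) u) u := by
  have key : HasDerivAt (fun u => ∑ A ∈ S.powerset, (-1 : ℝ) ^ (S.card - A.card) *
      phiAux α ε i j (u + ∑ ℓ ∈ A, s ℓ)) (∑ A ∈ S.powerset, (-1 : ℝ) ^ (S.card - A.card) *
      ((-α - i) * phiAux α ε (i + 1) j (u + ∑ ℓ ∈ A, s ℓ)
        + (α - j) * phiAux α ε i (j + 1) (u + ∑ ℓ ∈ A, s ℓ))) u := by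
    refine HasDerivAt.fun_sum fun A _ => ?_
    have hA : 0 < u + ∑ ℓ ∈ A, s ℓ := by
      have := Finset.sum_nonneg (s := A) fun ℓ _ => (hs ℓ).le
      linarith
    exact ((phiAux_hasDerivAt α ε hε i j _ hA).comp_add_const u _).const_mul _
  refine key.congr_deriv ?_
  simp only [iterDiff, Finset.mul_sum, ← Finset.sum_add_distrib]
  refine Finset.sum_congr rfl fun A _ => ?_
  ring

theorem wAux_nonneg {ι : Type*} (α ε : ℝ) (hε : 0 ≤ ε) (δ s : ι → ℝ) (hs : ∀ ℓ, 0 < s ℓ)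
    (S : Finset ι) (m : ℕ) (t : ℝ) (ht : 0 < t) : 0 ≤ wAux α ε δ s S m t := by
  have : 0 ≤ ∏ ℓ ∈ S, (s ℓ / t) ^ δ ℓ :=
    Finset.prod_nonneg fun ℓ _ => Real.rpow_nonneg (div_pos (hs ℓ) ht).le _
  unfold wAux
  positivity

theorem wAux_anti {ι : Type*} (α ε : ℝ) (hα : 0 < α) (hε : 0 ≤ ε) (δ s : ι → ℝ)
    (hδ : ∀ ℓ, δ ℓ ∈ Set.Icc (0 : ℝ) 1) (hs : ∀ ℓ, 0 < s ℓ)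
    (S : Finset ι) (m : ℕ) (t u : ℝ) (ht : 0 < t) (htu : t ≤ u) :
    wAux α ε δ s S m u ≤ wAux α ε δ s S m t := by
  have hu : 0 < u := ht.trans_le htu
  have h1 : (u / (1 + ε * u)) ^ (-α) ≤ (t / (1 + ε * t)) ^ (-α) := by
    refine Real.rpow_le_rpow_of_nonpos (by positivity) ?_ (by linarith)
    rw [div_le_div_iff₀ (by positivity) (by positivity)]
    nlinarith
  have h2 : (u⁻¹) ^ m ≤ (t⁻¹) ^ m := by gcongr
  have h3 : ∏ ℓ ∈ S, (s ℓ / u) ^ δ ℓ ≤ ∏ ℓ ∈ S, (s ℓ / t) ^ δ ℓ := by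
    refine Finset.prod_le_prod (fun ℓ _ => Real.rpow_nonneg (div_pos (hs ℓ) hu).le _)
      fun ℓ _ => ?_
    have := hs ℓ
    exact Real.rpow_le_rpow (by positivity) (by gcongr) (hδ ℓ).1
  have h4 : 0 ≤ ∏ ℓ ∈ S, (s ℓ / u) ^ δ ℓ :=
    Finset.prod_nonneg fun ℓ _ => Real.rpow_nonneg (div_pos (hs ℓ) hu).le _
  unfold wAux
  exact mul_le_mul (mul_le_mul h1 h2 (by positivity) (by positivity)) h3 h4 (by positivity)

theorem main_aux {ι : Type*} [DecidableEq ι] (α : ℝ) (hα : 0 < α) (δ : ι → ℝ)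
    (hδ : ∀ ℓ, δ ℓ ∈ Set.Icc (0 : ℝ) 1) (S : Finset ι) :
    ∀ i j : ℕ, ∃ c : ℝ, 0 < c ∧ ∀ ε : ℝ, 0 ≤ ε → ∀ s : ι → ℝ, (∀ ℓ, 0 < s ℓ) →
      ∀ t : ℝ, 0 < t →
        |iterDiff S s (phiAux α ε i j) t| ≤ c * wAux α ε δ s S (i + j) t := by
  induction S using Finset.induction_on with
  | empty =>
    intro i j
    refine ⟨1, one_pos, fun ε hε s hs t ht => ?_⟩
    have h : (ε / (1 + ε * t)) ^ j ≤ (t⁻¹) ^ j := by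
      refine pow_le_pow_left₀ (by positivity) ?_ j
      rw [inv_eq_one_div, div_le_div_iff₀ (by positivity) ht]
      linarith
    have h0 : 0 ≤ phiAux α ε i j t := by unfold phiAux; positivity
    have : iterDiff ∅ s (phiAux α ε i j) t = phiAux α ε i j t := by simp [iterDiff]
    rw [this, abs_of_nonneg h0, one_mul]
    simp only [phiAux, wAux, Finset.prod_empty, mul_one, pow_add]
    rw [← mul_assoc]
    exact mul_le_mul_of_nonneg_left h (by positivity)
  | insert a S ha ih =>
    intro i j
    obtain ⟨c0, hc0, H0⟩ := ih i j
    obtain ⟨c1, hc1, H1⟩ := ih (i + 1) j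
    obtain ⟨c2, hc2, H2⟩ := ih i (j + 1)
    set K := |-α - (i : ℝ)| * c1 + |α - (j : ℝ)| * c2 with hK
    have hK0 : 0 ≤ K := by positivity
    refine ⟨2 * c0 + K, by positivity, fun ε hε s hs t ht => ?_⟩
    have hsa := hs a
    rw [iterDiff_insert_aux S a ha]
    have hW := wAux_nonneg α ε hε δ s hs S (i + j) t ht
    have hw : wAux α ε δ s (insert a S) (i + j) t
        = (s a / t) ^ δ a * wAux α ε δ s S (i + j) t := by
      simp only [wAux, Finset.prod_insert ha]; ring
    rw [hw]
    set W := wAux α ε δ s S (i + j) t with hWdef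
    have hx : 0 < s a / t := by positivity
    by_cases hst : s a ≤ t
    · have hx1 : s a / t ≤ 1 := (div_le_one ht).2 hst
      have hxd : s a / t ≤ (s a / t) ^ δ a := by
        simpa using Real.rpow_le_rpow_of_exponent_ge hx hx1 (hδ a).2
      have hmv := Convex.norm_image_sub_le_of_norm_hasDerivWithin_le
        (f := iterDiff S s (phiAux α ε i j)) (s := Set.Icc t (t + s a)) (x := t) (y := t + s a)
        (C := K * (W / t))
        (fun u hu => (iterDiff_hasDerivAt_aux S s hs α ε hε i j u
          (ht.trans_le hu.1)).hasDerivWithinAt) ?_ (convex_Icc _ _)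
          ⟨le_rfl, by linarith⟩ ⟨by linarith, le_rfl⟩
      · rw [Real.norm_eq_abs, Real.norm_eq_abs, add_sub_cancel_left, abs_of_pos hsa] at hmv
        calc _ ≤ K * (W / t) * s a := hmv
          _ = K * W * (s a / t) := by ring
          _ ≤ K * W * (s a / t) ^ δ a := by gcongr
          _ ≤ (2 * c0 + K) * W * (s a / t) ^ δ a := by gcongr; linarith
          _ = _ := by ring
      · intro u hu
        have hu0 := ht.trans_le hu.1
        have hWt : wAux α ε δ s S (i + j + 1) t = W / t := by
          simp only [hWdef, wAux, pow_succ]; ring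
        have b1 := (H1 ε hε s hs u hu0)
        have b2 := (H2 ε hε s hs u hu0)
        have hm := wAux_anti α ε hα hε δ s hδ hs S (i + j + 1) t u ht hu.1
        rw [hWt] at hm
        rw [show i + 1 + j = i + j + 1 by ring] at b1
        rw [← add_assoc] at b2
        rw [Real.norm_eq_abs]
        refine (abs_add_le _ _).trans ?_
        rw [abs_mul, abs_mul, hK, add_mul, mul_assoc, mul_assoc]
        gcongr
        · exact b1.trans (by gcongr)
        · exact b2.trans (by gcongr)
    · have hx1 : 1 ≤ s a / t := (one_le_div ht).2 (not_le.1 hst).le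
      have hxd : 1 ≤ (s a / t) ^ δ a := Real.one_le_rpow hx1 (hδ a).1
      have b1 := H0 ε hε s hs t ht
      have b2 := H0 ε hε s hs (t + s a) (by linarith)
      have hm := wAux_anti α ε hα hε δ s hδ hs S (i + j) t (t + s a) ht (by linarith)
      have b3 := b2.trans (mul_le_mul_of_nonneg_left hm hc0.le)
      calc _ ≤ _ := abs_sub _ _
        _ ≤ c0 * W + c0 * W := add_le_add b3 b1
        _ = 2 * c0 * W * 1 := by ring
        _ ≤ (2 * c0 + K) * W * (s a / t) ^ δ a := by gcongr; linarith
        _ = _ := by ring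

/-- Lemma A.3, bound (Leibniz7): weighted bound on iterated finite differences of
`u ↦ F_ε(u)^{-α}` where `F_ε(u) = u/(1+εu)`. -/
theorem leibniz7 {L : Type*} [Fintype L] [DecidableEq L] (α : ℝ) (hα : 0 < α)
    (δ : L → ℝ) (hδ : ∀ ℓ, δ ℓ ∈ Set.Icc (0 : ℝ) 1) :
    ∃ c : ℝ, 0 < c ∧
      ∀ ε : ℝ, ε ∈ Set.Icc (0 : ℝ) 1 →
        ∀ s : L → ℝ, (∀ ℓ, 0 < s ℓ) → ∀ t : ℝ, 0 < t →
          |iterDiff (Finset.univ : Finset L) s (fun u => (u / (1 + ε * u)) ^ (-α)) t| ≤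
            c * (t / (1 + ε * t)) ^ (-α) * t ^ (-(∑ ℓ, δ ℓ)) * ∏ ℓ, s ℓ ^ δ ℓ := by
  obtain ⟨c, hc, H⟩ := main_aux α hα δ hδ (Finset.univ : Finset L) 0 0
  refine ⟨c, hc, fun ε hε s hs t ht => ?_⟩
  have h := H ε hε.1 s hs t ht
  have e1 : phiAux α ε 0 0 = fun u => (u / (1 + ε * u)) ^ (-α) := by
    funext u; simp [phiAux]
  have e2 : wAux α ε δ s Finset.univ (0 + 0) t
      = (t / (1 + ε * t)) ^ (-α) * (t ^ (-(∑ ℓ, δ ℓ)) * ∏ ℓ, s ℓ ^ δ ℓ) := by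
    have e3 : ∏ ℓ, (s ℓ / t) ^ δ ℓ = t ^ (-(∑ ℓ, δ ℓ)) * ∏ ℓ, s ℓ ^ δ ℓ := by
      rw [← Finset.sum_neg_distrib, Real.rpow_sum_of_pos ht, ← Finset.prod_mul_distrib]
      refine Finset.prod_congr rfl fun ℓ _ => ?_
      rw [Real.div_rpow (hs ℓ).le ht.le, Real.rpow_neg ht.le]
      ring
    simp only [wAux, e3, add_zero, pow_zero, mul_one]
  rw [e1, e2] at h
  refine h.trans (le_of_eq ?_)
  ring
end

section
/- Lemma A.3, bound (Leibniz-exp): let L be a finite index set. Then there exists a constant c > 0, depending only on #L, such that for all a > 0, all ε ∈ [0,1] with ε ≤ a, all δ : L → [0,1], all s : L → ℝ with s_ℓ > 0 for each ℓ ∈ L, and all t > 0: |Δ_{s_L}(u ↦ e^{a F_ε(u)})(t)| ≤ c · a^{|δ|} · e^{a F_ε(t)} · e^{a |s|} · Π_{ℓ∈L} s_ℓ^{δ_ℓ}, where |δ| := Σ_{ℓ∈L} δ_ℓ and |s| := Σ_{ℓ∈L} s_ℓ. -/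
open Finset

lemma iterDiff_insert {ι : Type*} [DecidableEq ι] (S : Finset ι) (i : ι) (hi : i ∉ S)
    (s : ι → ℝ) (g : ℝ → ℝ) (t : ℝ) :
    iterDiff (insert i S) s g t = iterDiff S s (fun u => g (u + s i) - g u) t := by
  unfold iterDiff
  rw [Finset.sum_powerset_insert hi, ← Finset.sum_add_distrib]
  apply Finset.sum_congr rfl
  intro A hA
  have hA' := Finset.mem_powerset.1 hA
  have hc := Finset.card_le_card hA'
  have hiA : i ∉ A := fun h => hi (hA' h)
  rw [Finset.card_insert_of_notMem hi, Finset.card_insert_of_notMem hiA,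
    Finset.sum_insert hiA]
  have e1 : S.card + 1 - A.card = (S.card - A.card) + 1 := by omega
  have e2 : S.card + 1 - (A.card + 1) = S.card - A.card := by omega
  rw [e1, e2, pow_succ]
  have e3 : t + (s i + ∑ x ∈ A, s x) = t + ∑ x ∈ A, s x + s i := by ring
  rw [e3]
  ring

lemma iterDiff_bound {ι : Type*} [DecidableEq ι] (a : ℝ) (ha : 0 < a) (E : ℝ → ℝ)
    (hE0 : ∀ u, 0 < E u)
    (hE : ∀ u r, 0 < u → 0 ≤ r → E (u + r) ≤ E u * Real.exp (a * r))
    (δ : ι → ℝ) (hδ : ∀ ℓ, δ ℓ ∈ Set.Icc (0 : ℝ) 1)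
    (s : ι → ℝ) (hs : ∀ ℓ, 0 < s ℓ) (t : ℝ) (ht : 0 < t) (S : Finset ι) :
    ∀ (C : ℝ) (G : ℕ → ℝ → ℝ), 0 ≤ C →
      (∀ k u, 0 < u → HasDerivAt (G k) (G (k + 1) u) u) →
      (∀ k u, k ≤ S.card → 0 < u → |G k u| ≤ C * a ^ k * E u) →
      |iterDiff S s (G 0) t| ≤
        2 ^ S.card * C * E t * ∏ ℓ ∈ S, (Real.exp (a * s ℓ) * (a * s ℓ) ^ δ ℓ) := by
  induction S using Finset.induction_on with
  | empty =>
    intro C G hC hG hB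
    simpa [iterDiff] using hB 0 t (by simp) ht
  | insert i S hi ih =>
    intro C G hC hG hB
    rw [iterDiff_insert S i hi]
    have hsi := hs i
    have has : 0 < a * s i := mul_pos ha hsi
    have hp : 0 < (a * s i) ^ δ i := Real.rpow_pos_of_pos has _
    have he : 1 ≤ Real.exp (a * s i) := Real.one_le_exp has.le
    have := ih (2 * C * (Real.exp (a * s i) * (a * s i) ^ δ i))
      (fun k u => G k (u + s i) - G k u) (by positivity) ?_ ?_
    · rw [Finset.prod_insert hi, Finset.card_insert_of_notMem hi, pow_succ]
      calc _ ≤ _ := this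
        _ = _ := by ring
    · intro k u hu
      exact ((hG k (u + s i) (by linarith)).comp_add_const u (s i)).sub (hG k u hu)
    · intro k u hk hu
      rw [Finset.card_insert_of_notMem hi] at hB
      have hEu := hE0 u
      have hak : 0 < a ^ k := pow_pos ha k
      have hmain : 0 ≤ C * a ^ k * E u * Real.exp (a * s i) := by positivity
      suffices h : |G k (u + s i) - G k u| ≤
          2 * (C * a ^ k * E u * Real.exp (a * s i)) * (a * s i) ^ δ i by
        calc _ ≤ _ := h
          _ = _ := by ring
      rcases le_total (a * s i) 1 with h1 | h1
      · have hx : a * s i ≤ (a * s i) ^ δ i := by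
          simpa using Real.rpow_le_rpow_of_exponent_ge has h1 (hδ i).2
        have hm : ‖G k (u + s i) - G k u‖ ≤
            (C * a ^ (k + 1) * E u * Real.exp (a * s i)) * ‖(u + s i) - u‖ := by
          apply Convex.norm_image_sub_le_of_norm_hasDerivWithin_le
            (f' := G (k + 1)) (s := Set.Icc u (u + s i))
          · intro x hx
            exact (hG k x (by linarith [hx.1])).hasDerivWithinAt
          · intro x hx
            have hx0 : 0 < x := by linarith [hx.1]
            have b1 := hB (k + 1) x (by omega) hx0
            have b2 := hE u (x - u) hu (by linarith [hx.1])
            rw [add_sub_cancel] at b2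
            have b3 : Real.exp (a * (x - u)) ≤ Real.exp (a * s i) := by
              apply Real.exp_le_exp.2
              apply mul_le_mul_of_nonneg_left _ ha.le
              linarith [hx.2]
            have b4 : E x ≤ E u * Real.exp (a * s i) :=
              b2.trans (mul_le_mul_of_nonneg_left b3 hEu.le)
            calc ‖G (k + 1) x‖ ≤ C * a ^ (k + 1) * E x := b1
              _ ≤ C * a ^ (k + 1) * (E u * Real.exp (a * s i)) :=
                mul_le_mul_of_nonneg_left b4 (by positivity)
              _ = _ := by ring
          · exact convex_Icc _ _
          · exact ⟨le_refl _, by linarith⟩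
          · exact ⟨by linarith, le_refl _⟩
        rw [add_sub_cancel_left, Real.norm_eq_abs, Real.norm_eq_abs, abs_of_pos hsi] at hm
        calc _ ≤ _ := hm
          _ = (C * a ^ k * E u * Real.exp (a * s i)) * (a * s i) := by ring
          _ ≤ (C * a ^ k * E u * Real.exp (a * s i)) * (a * s i) ^ δ i :=
            mul_le_mul_of_nonneg_left hx hmain
          _ ≤ _ := by nlinarith [mul_nonneg hmain hp.le]
      · have hx : 1 ≤ (a * s i) ^ δ i := Real.one_le_rpow h1 (hδ i).1
        have b1 := hB k u (by omega) hu
        have b2 := hB k (u + s i) (by omega) (by linarith)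
        have b3 := hE u (s i) hu hsi.le
        have b4 : C * a ^ k * E (u + s i) ≤ C * a ^ k * E u * Real.exp (a * s i) := by
          rw [mul_assoc (C * a ^ k)]
          exact mul_le_mul_of_nonneg_left b3 (by positivity)
        have b5 : C * a ^ k * E u ≤ C * a ^ k * E u * Real.exp (a * s i) :=
          le_mul_of_one_le_right (by positivity) he
        have b6 := abs_sub (G k (u + s i)) (G k u)
        have b7 := mul_le_mul_of_nonneg_left hx hmain
        linarith

open Polynomial in
/-- Polynomials `R_k(ρ, w)` with `(d/du)^k exp(aF) = a^k R_k(ε/a, 1/(1+εu)) exp(aF)`. -/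
noncomputable def expPoly : ℕ → Polynomial (Polynomial ℝ)
  | 0 => 1
  | k + 1 => X ^ 2 * expPoly k - C X * X ^ 2 * derivative (expPoly k)

lemma continuous_evalEval (p : Polynomial (Polynomial ℝ)) :
    Continuous (fun z : ℝ × ℝ => p.evalEval z.1 z.2) := by
  induction p using Polynomial.induction_on' with
  | add p q hp hq =>
    simp only [Polynomial.evalEval_add]
    exact Continuous.add hp hq
  | monomial n q =>
    simp only [Polynomial.evalEval, Polynomial.eval_monomial, Polynomial.eval_mul,
      Polynomial.eval_pow, Polynomial.eval_C]
    exact (q.continuous.comp continuous_fst).mul (continuous_snd.pow n)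

lemma expPoly_bound (n : ℕ) : ∃ C : ℝ, 0 < C ∧ ∀ k ≤ n, ∀ ρ ∈ Set.Icc (0 : ℝ) 1,
    ∀ w ∈ Set.Icc (0 : ℝ) 1, |(expPoly k).evalEval ρ w| ≤ C := by
  have h : ∀ k, ∃ C : ℝ, ∀ z ∈ Set.Icc (0 : ℝ) 1 ×ˢ Set.Icc (0 : ℝ) 1,
      ‖(expPoly k).evalEval z.1 z.2‖ ≤ C := fun k =>
    (isCompact_Icc.prod isCompact_Icc).exists_bound_of_continuousOn
      (continuous_evalEval (expPoly k)).continuousOn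
  choose C hC using h
  refine ⟨∑ k ∈ Finset.range (n + 1), |C k| + 1, by positivity, ?_⟩
  intro k hk ρ hρ w hw
  have h1 := hC k (ρ, w) ⟨hρ, hw⟩
  have h2 := Finset.single_le_sum (f := fun k => |C k|) (fun i _ => abs_nonneg _)
    (Finset.mem_range.2 (Nat.lt_succ_of_le hk))
  have h3 := le_abs_self (C k)
  simp only [Real.norm_eq_abs] at h1 h2
  linarith

lemma hasDerivAt_evalEval (p : Polynomial (Polynomial ℝ)) (ρ w : ℝ) :
    HasDerivAt (fun w => p.evalEval ρ w) (p.derivative.evalEval ρ w) w := by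
  have h := (p.map (Polynomial.evalRingHom ρ)).hasDerivAt w
  rw [Polynomial.derivative_map] at h
  simpa only [Polynomial.map_evalRingHom_eval] using h

lemma hasDerivAt_family (a ε : ℝ) (ha : 0 < a) (hε : 0 ≤ ε) (k : ℕ) (u : ℝ) (hu : 0 < u) :
    HasDerivAt (fun u => a ^ k * (expPoly k).evalEval (ε / a) (1 / (1 + ε * u)) *
        Real.exp (a * (u / (1 + ε * u))))
      (a ^ (k + 1) * (expPoly (k + 1)).evalEval (ε / a) (1 / (1 + ε * u)) *
        Real.exp (a * (u / (1 + ε * u)))) u := by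
  have hd : 1 + ε * u ≠ 0 := by positivity
  have hden : HasDerivAt (fun u : ℝ => 1 + ε * u) ε u := by
    simpa using ((hasDerivAt_id u).const_mul ε).const_add 1
  have hw : HasDerivAt (fun u : ℝ => 1 / (1 + ε * u)) (-ε * (1 / (1 + ε * u)) ^ 2) u := by
    refine ((hasDerivAt_const u (1 : ℝ)).div hden hd).congr_deriv ?_
    field_simp
    ring
  have hF : HasDerivAt (fun u : ℝ => a * (u / (1 + ε * u))) (a * (1 / (1 + ε * u)) ^ 2) u := by
    refine (((hasDerivAt_id u).div hden hd).const_mul a).congr_deriv ?_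
    simp only [id]
    field_simp
    ring
  have hp := (hasDerivAt_evalEval (expPoly k) (ε / a) (1 / (1 + ε * u))).comp u hw
  refine ((hp.const_mul (a ^ k)).mul hF.exp).congr_deriv ?_
  simp only [expPoly, Function.comp, Polynomial.evalEval_sub, Polynomial.evalEval_mul,
    Polynomial.evalEval_pow, Polynomial.evalEval_X, Polynomial.evalEval_C, Polynomial.eval_X]
  generalize (1 / (1 + ε * u)) = w
  field_simp
  ring

/-- Lemma A.3, bound (Leibniz-exp): weighted bound on iterated finite differences of
`u ↦ exp(a F_ε(u))` where `F_ε(u) = u/(1+εu)`, valid for `ε ≤ a`. -/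
theorem leibnizExp {L : Type*} [Fintype L] [DecidableEq L] :
    ∃ c : ℝ, 0 < c ∧
      ∀ a : ℝ, 0 < a → ∀ ε : ℝ, ε ∈ Set.Icc (0 : ℝ) 1 → ε ≤ a →
        ∀ δ : L → ℝ, (∀ ℓ, δ ℓ ∈ Set.Icc (0 : ℝ) 1) →
          ∀ s : L → ℝ, (∀ ℓ, 0 < s ℓ) → ∀ t : ℝ, 0 < t →
            |iterDiff (Finset.univ : Finset L) s
                (fun u => Real.exp (a * (u / (1 + ε * u)))) t| ≤
              c * a ^ (∑ ℓ, δ ℓ) * Real.exp (a * (t / (1 + ε * t))) *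
                Real.exp (a * ∑ ℓ, s ℓ) * ∏ ℓ, s ℓ ^ δ ℓ := by
  obtain ⟨C, hC, hb⟩ := expPoly_bound (Finset.univ : Finset L).card
  refine ⟨2 ^ (Finset.univ : Finset L).card * C, by positivity, ?_⟩
  intro a ha ε hε hεa δ hδ s hs t ht
  have hε0 := hε.1
  have key := iterDiff_bound a ha (fun u => Real.exp (a * (u / (1 + ε * u))))
    (fun u => Real.exp_pos _) ?_ δ hδ s hs t ht Finset.univ C
    (fun k u => a ^ k * (expPoly k).evalEval (ε / a) (1 / (1 + ε * u)) *
        Real.exp (a * (u / (1 + ε * u)))) hC.le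
    (fun k u hu => hasDerivAt_family a ε ha hε0 k u hu) ?_
  · have h0 : (fun u => a ^ 0 * (expPoly 0).evalEval (ε / a) (1 / (1 + ε * u)) *
        Real.exp (a * (u / (1 + ε * u)))) = fun u => Real.exp (a * (u / (1 + ε * u))) := by
      funext u
      simp [expPoly]
    rw [h0] at key
    refine key.trans (le_of_eq ?_)
    have e1 : ∏ ℓ, (a * s ℓ) ^ δ ℓ = a ^ (∑ ℓ, δ ℓ) * ∏ ℓ, s ℓ ^ δ ℓ := by
      rw [Real.rpow_sum_of_pos ha, ← Finset.prod_mul_distrib]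
      exact Finset.prod_congr rfl fun ℓ _ => Real.mul_rpow ha.le (hs ℓ).le
    rw [Finset.prod_mul_distrib, e1, ← Real.exp_sum, ← Finset.mul_sum]
    ring
  · intro u r hu hr
    rw [← Real.exp_add, ← mul_add]
    apply Real.exp_le_exp.2
    apply mul_le_mul_of_nonneg_left _ ha.le
    have h1 : 0 < 1 + ε * u := by positivity
    have h2 : 0 < 1 + ε * (u + r) := by positivity
    rw [div_add' _ _ _ h1.ne', div_le_div_iff₀ h2 h1]
    have : 0 ≤ r * ε * ((u + r) * (1 + ε * u) + u) := by positivity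
    nlinarith
  · intro k u hk hu
    have h1 : 1 ≤ 1 + ε * u := by nlinarith [mul_nonneg hε0 hu.le]
    have hw : 1 / (1 + ε * u) ∈ Set.Icc (0 : ℝ) 1 :=
      ⟨by positivity, by rw [div_le_one (by linarith)]; exact h1⟩
    have hr : ε / a ∈ Set.Icc (0 : ℝ) 1 := ⟨by positivity, by rw [div_le_one ha]; exact hεa⟩
    have := hb k hk _ hr _ hw
    rw [abs_mul, abs_mul, abs_of_pos (pow_pos ha k), Real.abs_exp, mul_comm (a ^ k)]
    gcongr
end
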